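/- Let ε ∈ (0, 3/4) and X ∈ St(p,n)^ε. Then the penalty gradient ∇N(X) = X(XᵀX − I_p) satisfies 4(1−ε)·N(X) ≤ ‖X(XᵀX − I_p)‖_F² ≤ 4(1+ε)·N(X), where N(X) := (1/4)‖XᵀX − I_p‖_F². -/

import Mathlib

open Matrix Finset

noncomputable section

/-- Frobenius inner product `⟨A, B⟩ = Tr (Aᵀ * B)`. -/
def finner {n p : ℕ} (A B : Matrix (Fin n) (Fin p) ℝ) : ℝ :=
  (Aᵀ * B).trace

/-- Frobenius norm `‖A‖_F = √(Tr (Aᵀ * A))`. -/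
def fnorm {n p : ℕ} (A : Matrix (Fin n) (Fin p) ℝ) : ℝ :=
  Real.sqrt ((Aᵀ * A).trace)

/-- Skew-symmetric part `skew M = (M - Mᵀ)/2`. -/
def skewPart {m : ℕ} (M : Matrix (Fin m) (Fin m) ℝ) : Matrix (Fin m) (Fin m) ℝ :=
  (1 / 2 : ℝ) • (M - Mᵀ)

/-- Symmetric part `sym M = (M + Mᵀ)/2`. -/
def symPart {m : ℕ} (M : Matrix (Fin m) (Fin m) ℝ) : Matrix (Fin m) (Fin m) ℝ :=
  (1 / 2 : ℝ) • (M + Mᵀ)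

/-- Penalty function `N(X) = ‖XᵀX - I‖_F² / 4`. -/
def penaltyN {n p : ℕ} (X : Matrix (Fin n) (Fin p) ℝ) : ℝ :=
  (1 / 4 : ℝ) * fnorm (Xᵀ * X - 1) ^ 2

/-- Landing direction `Λ̃(X; g) = skew(g Xᵀ) X + λ X (XᵀX - I)` with gradient estimate `g`. -/
def landingDir {n p : ℕ} (lam : ℝ) (X g : Matrix (Fin n) (Fin p) ℝ) :
    Matrix (Fin n) (Fin p) ℝ :=
  skewPart (g * Xᵀ) * X + lam • (X * (Xᵀ * X - 1))

section Frobenius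

attribute [local instance] Matrix.frobeniusSeminormedAddCommGroup

theorem trace_transpose_mul_eq_sum {n p : ℕ} (A B : Matrix (Fin n) (Fin p) ℝ) :
    (Aᵀ * B).trace = ∑ x : Fin p × Fin n, A x.2 x.1 * B x.2 x.1 := by
  rw [Fintype.sum_prod_type]
  simp [Matrix.trace, Matrix.mul_apply]

theorem trace_transpose_mul_self_nonneg {n p : ℕ} (A : Matrix (Fin n) (Fin p) ℝ) :
    0 ≤ (Aᵀ * A).trace := by
  rw [trace_transpose_mul_eq_sum]
  exact Finset.sum_nonneg fun x _ => mul_self_nonneg _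

theorem fnorm_sq {n p : ℕ} (A : Matrix (Fin n) (Fin p) ℝ) :
    fnorm A ^ 2 = (Aᵀ * A).trace :=
  Real.sq_sqrt (trace_transpose_mul_self_nonneg A)

theorem fnorm_eq_norm {n p : ℕ} (A : Matrix (Fin n) (Fin p) ℝ) : fnorm A = ‖A‖ := by
  rw [fnorm, trace_transpose_mul_eq_sum, Fintype.sum_prod_type_right, Matrix.frobenius_norm_def,
    Real.sqrt_eq_rpow]
  simp [sq]

theorem fnorm_mul_le {n m p : ℕ} (A : Matrix (Fin n) (Fin m) ℝ) (B : Matrix (Fin m) (Fin p) ℝ) :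
    fnorm (A * B) ≤ fnorm A * fnorm B := by
  simpa only [fnorm_eq_norm] using Matrix.frobenius_norm_mul A B

end Frobenius

/-- Cauchy–Schwarz inequality for the Frobenius inner product. -/
theorem abs_trace_transpose_mul_le {n p : ℕ} (A B : Matrix (Fin n) (Fin p) ℝ) :
    |(Aᵀ * B).trace| ≤ fnorm A * fnorm B := by
  refine abs_le_of_sq_le_sq ?_ (mul_nonneg (Real.sqrt_nonneg _) (Real.sqrt_nonneg _))
  rw [mul_pow, fnorm_sq, fnorm_sq]
  simp only [trace_transpose_mul_eq_sum, ← sq]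
  exact Finset.sum_mul_sq_le_sq_mul_sq _ _ _

theorem fnorm_mul_sub_one_sq {n p : ℕ} (X : Matrix (Fin n) (Fin p) ℝ) :
    fnorm (X * (Xᵀ * X - 1)) ^ 2 = fnorm (Xᵀ * X - 1) ^ 2 +
      ((Xᵀ * X - 1)ᵀ * ((Xᵀ * X - 1) * (Xᵀ * X - 1))).trace := by
  rw [fnorm_sq, fnorm_sq, ← Matrix.trace_add]
  simp only [Matrix.transpose_mul, Matrix.transpose_sub, Matrix.transpose_transpose,
    Matrix.transpose_one]
  congr 1
  simp only [Matrix.mul_sub, Matrix.sub_mul, Matrix.mul_assoc, Matrix.mul_one, Matrix.one_mul]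
  abel

/-- for `X` in the safe region, the penalty gradient `X(XᵀX - I)` satisfies
`4(1-ε) N(X) ≤ ‖X(XᵀX - I)‖_F² ≤ 4(1+ε) N(X)`. -/
theorem penalty_gradient_bounds {n p : ℕ} (ε : ℝ) (hε : ε ∈ Set.Ioo (0 : ℝ) (3 / 4))
    (X : Matrix (Fin n) (Fin p) ℝ) (hX : fnorm (Xᵀ * X - 1) ≤ ε) :
    4 * (1 - ε) * penaltyN X ≤ fnorm (X * (Xᵀ * X - 1)) ^ 2 ∧
    fnorm (X * (Xᵀ * X - 1)) ^ 2 ≤ 4 * (1 + ε) * penaltyN X := by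
  have hS : 0 ≤ fnorm (Xᵀ * X - 1) := Real.sqrt_nonneg _
  have hcubic : |((Xᵀ * X - 1)ᵀ * ((Xᵀ * X - 1) * (Xᵀ * X - 1))).trace| ≤
      ε * fnorm (Xᵀ * X - 1) ^ 2 :=
    calc
      _ ≤ fnorm (Xᵀ * X - 1) * fnorm ((Xᵀ * X - 1) * (Xᵀ * X - 1)) :=
        abs_trace_transpose_mul_le _ _
      _ ≤ fnorm (Xᵀ * X - 1) * (fnorm (Xᵀ * X - 1) * fnorm (Xᵀ * X - 1)) :=
        mul_le_mul_of_nonneg_left (fnorm_mul_le _ _) hS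
      _ = fnorm (Xᵀ * X - 1) * fnorm (Xᵀ * X - 1) ^ 2 := by ring
      _ ≤ ε * fnorm (Xᵀ * X - 1) ^ 2 := mul_le_mul_of_nonneg_right hX (sq_nonneg _)
  obtain ⟨hlower, hupper⟩ := abs_le.mp hcubic
  rw [fnorm_mul_sub_one_sq, penaltyN]
  constructor <;> linarith
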